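/- arXiv:1302.6741 — 2 statements merged into one kernel-verified Lean document; each statement's English description precedes it below -/
import Mathlib

section
/- Let f : [0,∞) → [0,∞) be invertible and continuously differentiable (with one-sided derivative at zero) with f'(s) > 0 for all s ≥ 0, and let h : ℝ^k → ℝ^k be the associated isotropic function. Then det(∇h(γ)) = f'(|γ|) (f(|γ|)/|γ|)^{k−1} for γ ≠ 0, and det(∇h(0)) = f'(0)^k. -/
open Filter Topology Set

noncomputable section

abbrev Euc (k : ℕ) := EuclideanSpace ℝ (Fin k)

/-- The isotropic function associated with `f`:
`h(γ) = f(‖γ‖) γ/‖γ‖` for `γ ≠ 0` and `h(0) = 0`. -/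
def isotropic {k : ℕ} (f : ℝ → ℝ) (γ : Euc k) : Euc k :=
  haveI := Classical.dec (γ = 0)
  if γ = 0 then 0 else (f ‖γ‖ / ‖γ‖) • γ

theorem hasFDerivAt_norm_of_ne_zero {E : Type*} [NormedAddCommGroup E] [InnerProductSpace ℝ E]
    {x : E} (hx : x ≠ 0) : HasFDerivAt (fun y : E => ‖y‖) (‖x‖⁻¹ • innerSL ℝ x) x := by
  have hx' : ‖x‖ ≠ 0 := norm_ne_zero_iff.mpr hx
  have h := (hasStrictFDerivAt_norm_sq x).hasFDerivAt.sqrt (pow_ne_zero 2 hx')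
  simp only [Real.sqrt_sq (norm_nonneg _)] at h
  refine h.congr_fderiv ?_
  ext y
  simp
  field_simp

theorem det_smul_id_add_smulRight {E : Type*} [NormedAddCommGroup E] [NormedSpace ℝ E]
    [FiniteDimensional ℝ E] {c : ℝ} (hc : c ≠ 0) (φ : E →L[ℝ] ℝ) (v : E) :
    (c • ContinuousLinearMap.id ℝ E + φ.smulRight v).det =
      c ^ Module.finrank ℝ E * (1 + c⁻¹ * φ v) := by
  have h : ((c • ContinuousLinearMap.id ℝ E + φ.smulRight v : E →L[ℝ] E) : E →ₗ[ℝ] E) =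
      c • LinearMap.transvection (φ : E →ₗ[ℝ] ℝ) (c⁻¹ • v) := by
    ext x
    simp [LinearMap.transvection.apply, smul_smul, mul_left_comm c, mul_inv_cancel₀ hc]
  rw [ContinuousLinearMap.det, h, LinearMap.det_smul, LinearMap.transvection.det]
  simp

theorem hasFDerivAt_isotropic {k : ℕ} {f : ℝ → ℝ} {a : ℝ} {γ : Euc k} (hγ : γ ≠ 0)
    (hf : HasDerivAt f a ‖γ‖) :
    HasFDerivAt (isotropic f)
      ((f ‖γ‖ / ‖γ‖) • ContinuousLinearMap.id ℝ (Euc k) +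
        (((a * ‖γ‖ - f ‖γ‖) / ‖γ‖ ^ 2) • ‖γ‖⁻¹ • innerSL ℝ γ).smulRight γ) γ := by
  have hq : HasDerivAt (fun r => f r / r) ((a * ‖γ‖ - f ‖γ‖) / ‖γ‖ ^ 2) ‖γ‖ := by
    simpa using hf.fun_div (hasDerivAt_id' ‖γ‖) (norm_ne_zero_iff.mpr hγ)
  have h := (hq.comp_hasFDerivAt γ (hasFDerivAt_norm_of_ne_zero hγ)).smul (hasFDerivAt_id γ)
  refine h.congr_of_eventuallyEq ?_
  filter_upwards [isOpen_ne.mem_nhds hγ] with x hx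
  simp [isotropic, show x ≠ 0 from hx]

theorem hasFDerivAt_isotropic_zero {k : ℕ} {f : ℝ → ℝ} {a : ℝ} (h0 : f 0 = 0)
    (hf : HasDerivWithinAt f a (Ici 0) 0) :
    HasFDerivAt (isotropic f) (a • ContinuousLinearMap.id ℝ (Euc k)) 0 := by
  rw [hasDerivWithinAt_iff_isLittleO] at hf
  have hn : Tendsto (fun x : Euc k => ‖x‖) (𝓝 0) (𝓝[Ici 0] 0) :=
    tendsto_nhdsWithin_iff.mpr
      ⟨tendsto_norm_zero, Eventually.of_forall fun x => norm_nonneg x⟩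
  rw [hasFDerivAt_iff_isLittleO]
  refine ((hf.comp_tendsto hn).norm_norm.congr (fun x => ?_) fun x => ?_).of_norm_norm
  · by_cases hx : x = 0
    · simp [hx, h0, isotropic]
    · have hx' : ‖x‖ ≠ 0 := norm_ne_zero_iff.mpr hx
      have : isotropic f x - isotropic f 0 - (a • ContinuousLinearMap.id ℝ (Euc k)) (x - 0) =
          (f ‖x‖ / ‖x‖ - a) • x := by
        simp [isotropic, hx, sub_smul]
      rw [this, norm_smul, ← norm_norm x, ← norm_mul, norm_norm]
      simp only [Function.comp_apply, h0, sub_zero, smul_eq_mul]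
      congr 1
      field_simp
  · simp

theorem map_zero_of_bijOn_Ici {f f' : ℝ → ℝ} (hbij : BijOn f (Ici 0) (Ici 0))
    (hderiv : ∀ s ∈ Ici (0 : ℝ), HasDerivWithinAt f (f' s) (Ici 0) s)
    (hpos : ∀ s ∈ Ici (0 : ℝ), 0 < f' s) : f 0 = 0 := by
  obtain ⟨x, hx, hfx⟩ := hbij.surjOn (self_mem_Ici (a := (0 : ℝ)))
  rcases (mem_Ici.mp hx).eq_or_lt with rfl | hx0
  · exact hfx
  · have hmin : IsLocalMin f x := by
      filter_upwards [Ici_mem_nhds hx0] with y hy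
      rw [hfx]
      exact hbij.mapsTo hy
    exact absurd (hmin.hasDerivAt_eq_zero ((hderiv x hx).hasDerivAt (Ici_mem_nhds hx0)))
      (hpos x hx).ne'

/-- `det(∇h(γ)) = f'(‖γ‖)(f(‖γ‖)/‖γ‖)^{k-1}` for `γ ≠ 0`, and
`det(∇h(0)) = f'(0)^k`. -/
theorem stmt2 {k : ℕ} (f f' : ℝ → ℝ)
    (hmaps : Set.MapsTo f (Set.Ici 0) (Set.Ici 0))
    (hbij : Set.BijOn f (Set.Ici 0) (Set.Ici 0))
    (hderiv : ∀ s ∈ Set.Ici (0 : ℝ), HasDerivWithinAt f (f' s) (Set.Ici 0) s)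
    (hcont : ContinuousOn f' (Set.Ici 0))
    (hpos : ∀ s ∈ Set.Ici (0 : ℝ), 0 < f' s) :
    (∀ γ : Euc k, γ ≠ 0 →
      (fderiv ℝ (isotropic f) γ).det = f' ‖γ‖ * (f ‖γ‖ / ‖γ‖) ^ (k - 1)) ∧
    (fderiv ℝ (isotropic f) (0 : Euc k)).det = f' 0 ^ k := by
  have h0 := map_zero_of_bijOn_Ici hbij hderiv hpos
  refine ⟨fun γ hγ => ?_, ?_⟩
  · have hr : 0 < ‖γ‖ := norm_pos_iff.mpr hγ
    have hf : f ‖γ‖ ≠ 0 := fun h =>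
      hr.ne' (hbij.injOn (mem_Ici.mpr hr.le) self_mem_Ici (h.trans h0.symm))
    have hk : k ≠ 0 := by
      rintro rfl
      exact hγ (Subsingleton.elim _ _)
    have hd := (hderiv ‖γ‖ (mem_Ici.mpr hr.le)).hasDerivAt (Ici_mem_nhds hr)
    rw [(hasFDerivAt_isotropic hγ hd).fderiv,
      det_smul_id_add_smulRight (div_ne_zero hf hr.ne'), finrank_euclideanSpace_fin,
      ← pow_sub_one_mul hk]
    simp only [smul_apply, innerSL_apply_apply, smul_eq_mul,
      real_inner_self_eq_norm_sq]
    field_simp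
    ring
  · rw [(hasFDerivAt_isotropic_zero h0 (hderiv 0 self_mem_Ici)).fderiv]
    simp [ContinuousLinearMap.det, LinearMap.det_smul]
end
end

section
/- Let f : [0,∞) → [0,∞) be invertible and twice continuously differentiable (with one-sided derivatives at zero) with f'(s) > 0 for all s ≥ 0 and f''(0) = 0, and let h : ℝ^k → ℝ^k be the associated isotropic function. Then the map γ ↦ det(∇h(γ)) is continuously differentiable on ℝ^k, and its gradient at 0 equals 0. -/
open Filter Topology Set

noncomputable section

/-- A radial function whose profile is `C¹` on `[0, ∞)` with vanishing derivative at `0`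
is differentiable everywhere. -/
theorem hasFDerivAt_comp_norm {E : Type*} [NormedAddCommGroup E] [InnerProductSpace ℝ E]
    {g g' : ℝ → ℝ} (hg : ∀ s ∈ Ici (0 : ℝ), HasDerivWithinAt g (g' s) (Ici 0) s)
    (h0 : g' 0 = 0) (x : E) :
    HasFDerivAt (fun y : E => g ‖y‖) ((g' ‖x‖ / ‖x‖) • innerSL ℝ x) x := by
  rcases eq_or_ne x 0 with rfl | hx
  · have h := hg 0 self_mem_Ici
    rw [h0, hasDerivWithinAt_iff_isLittleO] at h
    have hn : Tendsto (fun y : E => ‖y‖) (𝓝 0) (𝓝[Ici 0] 0) :=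
      tendsto_nhdsWithin_iff.2 ⟨tendsto_norm_zero, .of_forall fun y => norm_nonneg y⟩
    rw [hasFDerivAt_iff_isLittleO]
    have := h.comp_tendsto hn
    simp only [Function.comp_def, sub_zero, smul_zero] at this
    simpa using this.of_norm_right
  · have hpos : 0 < ‖x‖ := norm_pos_iff.2 hx
    have hn : HasFDerivAt (fun y : E => ‖y‖) (‖x‖⁻¹ • innerSL ℝ x) x := by
      have h := (hasFDerivAt_id x).norm_sq.sqrt (by simpa using hx)
      simp only [id, Real.sqrt_sq (norm_nonneg _)] at h
      refine h.congr_fderiv ?_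
      ext y
      simp
      field_simp
    have h := ((hg _ hpos.le).hasDerivAt (Ici_mem_nhds hpos)).comp_hasFDerivAt x hn
    rwa [smul_smul, ← div_eq_mul_inv] at h

theorem contDiff_comp_norm {E : Type*} [NormedAddCommGroup E] [InnerProductSpace ℝ E]
    {g g' : ℝ → ℝ} (hg : ∀ s ∈ Ici (0 : ℝ), HasDerivWithinAt g (g' s) (Ici 0) s)
    (hc : ContinuousOn g' (Ici 0)) (h0 : g' 0 = 0) :
    ContDiff ℝ 1 (fun y : E => g ‖y‖) := by
  refine contDiff_one_iff_hasFDerivAt.2 ⟨_, ?_, hasFDerivAt_comp_norm hg h0⟩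
  have hc' : Continuous fun x : E => g' ‖x‖ :=
    hc.comp_continuous continuous_norm fun x => norm_nonneg x
  refine continuous_iff_continuousAt.2 fun x => ?_
  rcases eq_or_ne x 0 with rfl | hx
  · have hlim := hc'.tendsto 0
    simp only [norm_zero, h0] at hlim
    simp only [ContinuousAt, norm_zero, map_zero, smul_zero]
    refine squeeze_zero_norm (fun y => ?_) (by simpa using hlim.norm)
    rw [norm_smul, innerSL_apply_norm, norm_div, norm_norm]
    rcases eq_or_ne ‖y‖ 0 with hy | hy
    · simp [hy]
    · rw [div_mul_cancel₀ _ hy, Real.norm_eq_abs]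
  · exact (hc'.continuousAt.div continuous_norm.continuousAt (norm_ne_zero_iff.2 hx)).smul
      (innerSL ℝ).continuous.continuousAt

theorem det_smul_id_add_smulRight_s3 {K V : Type*} [Field K] [AddCommGroup V] [Module K V]
    [FiniteDimensional K V] {a : K} (ha : a ≠ 0) (l : Module.Dual K V) (v : V) :
    LinearMap.det (a • LinearMap.id + l.smulRight v) =
      a ^ Module.finrank K V * (1 + l v / a) := by
  have h : a • LinearMap.id + l.smulRight v = a • LinearMap.transvection (a⁻¹ • l) v := by
    ext x
    simp [LinearMap.transvection.apply, smul_smul, ha]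
  rw [h, LinearMap.det_smul, LinearMap.transvection.det]
  simp [div_eq_inv_mul]

section Slope

variable {f f' f'' : ℝ → ℝ}

/-- The quotient `f s / s`, continuously extended at `0` by the derivative. -/
def slopeAtZero (f f' : ℝ → ℝ) : ℝ → ℝ :=
  Function.update (fun s => f s / s) 0 (f' 0)

theorem slopeAtZero_of_ne {s : ℝ} (hs : s ≠ 0) : slopeAtZero f f' s = f s / s :=
  Function.update_of_ne hs _ _

theorem slopeAtZero_zero : slopeAtZero f f' 0 = f' 0 :=
  Function.update_self _ _ _

theorem hasDerivAt_slopeAtZero {s : ℝ} (hs : 0 < s)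
    (hf : ∀ s ∈ Ici (0 : ℝ), HasDerivWithinAt f (f' s) (Ici 0) s) :
    HasDerivAt (slopeAtZero f f') ((s * f' s - f s) / s ^ 2) s := by
  have h := ((hf s hs.le).hasDerivAt (Ici_mem_nhds hs)).fun_div (hasDerivAt_id s) hs.ne'
  refine (h.congr_deriv (by simp [mul_comm])).congr_of_eventuallyEq ?_
  filter_upwards [eventually_ne_nhds hs.ne'] with t ht using slopeAtZero_of_ne ht

theorem tendsto_deriv_slopeAtZero (h0 : f 0 = 0)
    (hf : ∀ s ∈ Ici (0 : ℝ), HasDerivWithinAt f (f' s) (Ici 0) s)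
    (hf' : ∀ s ∈ Ici (0 : ℝ), HasDerivWithinAt f' (f'' s) (Ici 0) s)
    (hc : ContinuousOn f'' (Ici 0)) (hf'' : f'' 0 = 0) :
    Tendsto (fun s => (s * f' s - f s) / s ^ 2) (𝓝[>] 0) (𝓝 0) := by
  have hle : 𝓝[>] (0 : ℝ) ≤ 𝓝[≥] 0 := nhdsWithin_mono _ Ioi_subset_Ici_self
  have hid : Tendsto (fun s : ℝ => s) (𝓝[>] 0) (𝓝 0) := tendsto_id.mono_left inf_le_left
  have hf0 := ((hf 0 self_mem_Ici).continuousWithinAt.tendsto).mono_left hle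
  have hf'0 := ((hf' 0 self_mem_Ici).continuousWithinAt.tendsto).mono_left hle
  have hf''0 := ((hc 0 self_mem_Ici).tendsto).mono_left hle
  refine HasDerivAt.lhopital_zero_nhdsGT (f' := fun s => s * f'' s) (g' := fun s => 2 * s)
    ?_ ?_ ?_ ?_ ?_ ?_
  · filter_upwards [self_mem_nhdsWithin] with s hs
    have hs' : Ici (0 : ℝ) ∈ 𝓝 s := Ici_mem_nhds hs
    have h1 := (hf s (mem_Ici_of_Ioi hs)).hasDerivAt hs'
    have h2 := (hf' s (mem_Ici_of_Ioi hs)).hasDerivAt hs'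
    exact (((hasDerivAt_id' s).fun_mul h2).fun_sub h1).congr_deriv (by ring)
  · exact .of_forall fun s => by simpa using hasDerivAt_pow 2 s
  · filter_upwards [self_mem_nhdsWithin] with s hs
    exact mul_ne_zero two_ne_zero (ne_of_gt hs)
  · simpa [h0] using (hid.mul hf'0).sub hf0
  · simpa using hid.pow 2
  · rw [hf''] at hf''0
    refine Tendsto.congr' ?_ (by simpa using hf''0.div_const 2)
    filter_upwards [self_mem_nhdsWithin] with s hs
    have : s ≠ 0 := ne_of_gt hs
    field_simp

theorem hasDerivWithinAt_slopeAtZero (h0 : f 0 = 0)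
    (hf : ∀ s ∈ Ici (0 : ℝ), HasDerivWithinAt f (f' s) (Ici 0) s)
    (hf' : ∀ s ∈ Ici (0 : ℝ), HasDerivWithinAt f' (f'' s) (Ici 0) s)
    (hc : ContinuousOn f'' (Ici 0)) (hf'' : f'' 0 = 0) (s : ℝ) (hs : s ∈ Ici (0 : ℝ)) :
    HasDerivWithinAt (slopeAtZero f f') ((s * f' s - f s) / s ^ 2) (Ici 0) s := by
  rcases (mem_Ici.1 hs).eq_or_lt with rfl | hs
  · have hlim := tendsto_deriv_slopeAtZero h0 hf hf' hc hf''
    simp only [ne_eq, OfNat.ofNat_ne_zero, not_false_eq_true, zero_pow, div_zero]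
    refine hasDerivWithinAt_Ici_of_tendsto_deriv (s := Ioi 0)
      (fun t ht => (hasDerivAt_slopeAtZero ht hf).differentiableAt.differentiableWithinAt)
      ?_ self_mem_nhdsWithin ?_
    · have h := (hasDerivWithinAt_iff_tendsto_slope' self_notMem_Ioi).1
        ((hf 0 self_mem_Ici).mono Ioi_subset_Ici_self)
      rw [ContinuousWithinAt, slopeAtZero_zero]
      refine h.congr' ?_
      filter_upwards [self_mem_nhdsWithin] with t ht
      rw [slopeAtZero_of_ne (ne_of_gt ht), slope_def_field, h0, sub_zero, sub_zero]
    · refine hlim.congr' ?_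
      filter_upwards [self_mem_nhdsWithin] with t ht
      exact (hasDerivAt_slopeAtZero ht hf).deriv.symm
  · exact (hasDerivAt_slopeAtZero hs hf).hasDerivWithinAt

theorem continuousOn_deriv_slopeAtZero (h0 : f 0 = 0)
    (hf : ∀ s ∈ Ici (0 : ℝ), HasDerivWithinAt f (f' s) (Ici 0) s)
    (hf' : ∀ s ∈ Ici (0 : ℝ), HasDerivWithinAt f' (f'' s) (Ici 0) s)
    (hc : ContinuousOn f'' (Ici 0)) (hf'' : f'' 0 = 0) :
    ContinuousOn (fun s => (s * f' s - f s) / s ^ 2) (Ici 0) := by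
  intro s hs
  rcases (mem_Ici.1 hs).eq_or_lt with rfl | hs'
  · rw [← continuousWithinAt_Ioi_iff_Ici, ContinuousWithinAt]
    simpa using tendsto_deriv_slopeAtZero h0 hf hf' hc hf''
  · exact ((continuousWithinAt_id.mul (hf' s hs).continuousWithinAt).sub
      (hf s hs).continuousWithinAt).div (continuousWithinAt_id.pow 2) (pow_ne_zero 2 hs'.ne')

end Slope

theorem isotropic_eq_slopeAtZero_smul {k : ℕ} (f f' : ℝ → ℝ) :
    (isotropic f : Euc k → Euc k) = fun γ => slopeAtZero f f' ‖γ‖ • γ := by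
  ext1 γ
  by_cases h : γ = 0
  · simp [isotropic, h]
  · simp [isotropic, h, slopeAtZero_of_ne]

/-- if moreover `f` is twice continuously differentiable (one-sided at zero)
with `f''(0) = 0`, then `γ ↦ det(∇h(γ))` is continuously differentiable on `ℝ^k` and its
gradient at `0` is `0`. -/
theorem stmt3 {k : ℕ} (f f' : ℝ → ℝ)
    (hmaps : Set.MapsTo f (Set.Ici 0) (Set.Ici 0))
    (hbij : Set.BijOn f (Set.Ici 0) (Set.Ici 0))
    (hderiv : ∀ s ∈ Set.Ici (0 : ℝ), HasDerivWithinAt f (f' s) (Set.Ici 0) s)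
    (hcont : ContinuousOn f' (Set.Ici 0))
    (hpos : ∀ s ∈ Set.Ici (0 : ℝ), 0 < f' s)
    (f'' : ℝ → ℝ)
    (hderiv2 : ∀ s ∈ Set.Ici (0 : ℝ), HasDerivWithinAt f' (f'' s) (Set.Ici 0) s)
    (hcont2 : ContinuousOn f'' (Set.Ici 0))
    (hf''0 : f'' 0 = 0) :
    ContDiff ℝ 1 (fun γ : Euc k => (fderiv ℝ (isotropic f) γ).det) ∧
    gradient (fun γ : Euc k => (fderiv ℝ (isotropic f) γ).det) 0 = 0 := by
  have hmono : StrictMonoOn f (Ici 0) := by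
    refine strictMonoOn_of_deriv_pos (convex_Ici 0)
      (fun s hs => (hderiv s hs).continuousWithinAt) fun s hs => ?_
    rw [interior_Ici] at hs
    rw [((hderiv s (mem_Ici_of_Ioi hs)).hasDerivAt (Ici_mem_nhds hs)).deriv]
    exact hpos s (mem_Ici_of_Ioi hs)
  have h0 : f 0 = 0 := by
    obtain ⟨t, ht, hft⟩ := hbij.surjOn (self_mem_Ici (a := (0 : ℝ)))
    exact le_antisymm (hft ▸ hmono.monotoneOn self_mem_Ici ht ht) (hmaps self_mem_Ici)
  set φ := slopeAtZero f f' with hφ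
  have hφpos : ∀ s ∈ Ici (0 : ℝ), 0 < φ s := by
    intro s hs
    rcases (mem_Ici.1 hs).eq_or_lt with rfl | hs'
    · rw [hφ, slopeAtZero_zero]
      exact hpos 0 hs
    · rw [hφ, slopeAtZero_of_ne hs'.ne']
      exact div_pos (h0 ▸ hmono self_mem_Ici hs hs') hs'
  have hφd := hasDerivWithinAt_slopeAtZero h0 hderiv hderiv2 hcont2 hf''0
  have hφc := continuousOn_deriv_slopeAtZero h0 hderiv hderiv2 hcont2 hf''0
  have hdet : (fun γ : Euc k => (fderiv ℝ (isotropic f) γ).det) =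
      fun γ => φ ‖γ‖ ^ k * (f' ‖γ‖ / φ ‖γ‖) := by
    ext1 γ
    have hne := (hφpos ‖γ‖ (norm_nonneg γ)).ne'
    have h := (hasFDerivAt_comp_norm hφd (by simp) γ).fun_smul (hasFDerivAt_id γ)
    rw [isotropic_eq_slopeAtZero_smul f f']
    have hfd := h.fderiv
    simp only [id] at hfd
    rw [hfd]
    have hd := det_smul_id_add_smulRight_s3 hne
      ((((‖γ‖ * f' ‖γ‖ - f ‖γ‖) / ‖γ‖ ^ 2 / ‖γ‖) • innerSL ℝ γ : Euc k →L[ℝ] ℝ) :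
        Euc k →ₗ[ℝ] ℝ) γ
    rw [finrank_euclideanSpace_fin] at hd
    refine Eq.trans hd ?_
    congr 1
    rcases eq_or_ne γ 0 with rfl | hγ
    · simp [hφ, slopeAtZero_zero, (hpos 0 self_mem_Ici).ne']
    · have hn : ‖γ‖ ≠ 0 := norm_ne_zero_iff.2 hγ
      have hfφ : f ‖γ‖ = φ ‖γ‖ * ‖γ‖ := by
        rw [hφ, slopeAtZero_of_ne hn, div_mul_cancel₀ _ hn]
      simp only [ContinuousLinearMap.coe_coe, smul_apply, innerSL_apply_apply,
        real_inner_self_eq_norm_sq, smul_eq_mul, hfφ]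
      field_simp
      ring
  have hφ1 : ContDiff ℝ 1 fun γ : Euc k => φ ‖γ‖ := contDiff_comp_norm hφd hφc (by simp)
  have hf1 : ContDiff ℝ 1 fun γ : Euc k => f' ‖γ‖ := contDiff_comp_norm hderiv2 hcont2 hf''0
  have hφne : ∀ γ : Euc k, φ ‖γ‖ ≠ 0 := fun γ => (hφpos _ (norm_nonneg γ)).ne'
  rw [hdet]
  refine ⟨(hφ1.pow k).mul (hf1.div hφ1 hφne), ?_⟩
  have hφ0 : HasFDerivAt (fun γ : Euc k => φ ‖γ‖) (0 : Euc k →L[ℝ] ℝ) 0 := by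
    simpa using hasFDerivAt_comp_norm hφd (by simp) (0 : Euc k)
  have hf0 : HasFDerivAt (fun γ : Euc k => f' ‖γ‖) (0 : Euc k →L[ℝ] ℝ) 0 := by
    simpa using hasFDerivAt_comp_norm hderiv2 hf''0 (0 : Euc k)
  have h := (hφ0.pow k).fun_mul (hf0.fun_mul ((hasDerivAt_inv (hφne 0)).comp_hasFDerivAt 0 hφ0))
  simp only [Function.comp_apply, ← div_eq_mul_inv] at h
  rw [gradient, h.fderiv]
  simp
end
end
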